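/- arXiv:1807.03961 — 2 statements merged into one kernel-verified Lean document; each statement's English description precedes it below -/
import Mathlib

section
/- Let μ and ν be nonnegative finite Borel measures on ℝ^N and suppose there exists a constant C > 0 such that |φ|_{L^{r(x)}_ν(ℝ^N)} ≤ C |φ|_{L^{p(x)}_μ(ℝ^N)} for all φ ∈ C_c^∞(ℝ^N), where p, r : ℝ^N → ℝ are continuous with 1 < inf p ≤ sup p < ∞, 1 < inf r ≤ sup r < ∞, and inf_{ℝ^N}(r − p) > 0. Then there exist an at most countable family {x_i}_{i∈I} of distinct points in ℝ^N and positive numbers {ν_i}_{i∈I} such that ν = Σ_{i∈I} ν_i δ_{x_i}, where δ_{x_i} is the Dirac measure at x_i. -/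
open MeasureTheory Filter Topology

/-- The Luxemburg norm `|φ|_{L^{r(x)}_μ(ℝ^N)}` with respect to a measure `μ`. -/
noncomputable def luxNormM {N : ℕ} (μ : Measure (EuclideanSpace ℝ (Fin N)))
    (r φ : EuclideanSpace ℝ (Fin N) → ℝ) : ℝ :=
  sInf {c : ℝ | 0 < c ∧ ∫ x, |φ x / c| ^ r x ∂μ ≤ 1}

open Set Function

section Measure

variable {X : Type*} [TopologicalSpace X] [MeasurableSpace X]

/-- A measure that is locally bounded by `ε • μ` around the points of `S` is bounded by `ε • μ`
on `S`. -/
lemma measure_le_mul_of_forall_exists_isOpen [SecondCountableTopology X] [OpensMeasurableSpace X]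
    {μ ν : Measure X} {ε : ENNReal} {S : Set X} (hS : MeasurableSet S)
    (h : ∀ x ∈ S, ∃ V, IsOpen V ∧ x ∈ V ∧ ∀ A ⊆ V, MeasurableSet A → ν A ≤ ε * μ A) :
    ν S ≤ ε * μ S := by
  rcases S.eq_empty_or_nonempty with rfl | hne
  · simp
  choose! V hVo hxV hV using h
  obtain ⟨t, htS, htc, hcov⟩ := TopologicalSpace.countable_cover_nhdsWithin
    (fun x hx => mem_nhdsWithin_of_mem_nhds ((hVo x hx).mem_nhds (hxV x hx)))
  have htne : t.Nonempty := by
    obtain ⟨x, hx⟩ := hne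
    obtain ⟨y, hy, -⟩ := mem_iUnion₂.1 (hcov hx)
    exact ⟨y, hy⟩
  obtain ⟨u, rfl⟩ := htc.exists_eq_range htne
  have hu (n : ℕ) : u n ∈ S := htS (mem_range_self n)
  let D : ℕ → Set X := fun n => S ∩ disjointed (fun k => V (u k)) n
  have hDm (n : ℕ) : MeasurableSet (D n) :=
    hS.inter (MeasurableSet.disjointed (fun k => (hVo _ (hu k)).measurableSet) n)
  have hDd : Pairwise (Disjoint on D) := fun i j hij =>
    (disjoint_disjointed (fun k => V (u k)) hij).mono inter_subset_right inter_subset_right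
  have hDS : ⋃ n, D n = S := by
    rw [← inter_iUnion, iUnion_disjointed, inter_eq_left]
    simpa using hcov
  rw [← hDS, measure_iUnion hDd hDm, measure_iUnion hDd hDm, ← ENNReal.tsum_mul_left]
  exact ENNReal.tsum_le_tsum fun n =>
    hV _ (hu n) _ (inter_subset_right.trans (disjointed_subset _ n)) (hDm n)

end Measure

/-- A finite measure concentrated on a countable set is a countable sum of Dirac masses. -/
lemma exists_eq_sum_dirac_of_countable {X : Type} [MeasurableSpace X] [MeasurableSingletonClass X]
    {ν : Measure X} [IsFiniteMeasure ν] {D : Set X} (hD : D.Countable) (hν : ν Dᶜ = 0) :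
    ∃ (ι : Type) (_ : Countable ι) (x : ι → X) (c : ι → ℝ),
      Injective x ∧ (∀ i, 0 < c i) ∧
      ν = Measure.sum (fun i => (ENNReal.ofReal (c i)) • Measure.dirac (x i)) := by
  let E : Set X := {x ∈ D | ν {x} ≠ 0}
  have hEc : E.Countable := hD.mono (sep_subset _ _)
  have hE : ν Eᶜ = 0 := by
    have h₁ : ν {x ∈ D | ν {x} = 0} = 0 := by
      rw [← biUnion_of_singleton {x ∈ D | ν {x} = 0},
        measure_biUnion_null_iff (hD.mono (sep_subset _ _))]
      exact fun x hx => hx.2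
    refine measure_mono_null (fun x hx => ?_) (measure_union_null hν h₁)
    by_cases hxD : x ∈ D
    · exact Or.inr ⟨hxD, by_contra fun h => hx ⟨hxD, h⟩⟩
    · exact Or.inl hxD
  refine ⟨E, hEc.to_subtype, (↑), fun i => ν.real {(i : X)}, Subtype.val_injective,
    fun i => ENNReal.toReal_pos i.2.2 (measure_ne_top _ _), ?_⟩
  have := hEc.to_subtype
  ext s hs
  have hsum : ν s = ν (⋃ i : E, s ∩ {(i : X)}) := by
    refine measure_congr ?_
    have : ∀ᵐ x ∂ν, x ∈ E := hE
    filter_upwards [this] with x hx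
    refine propext ⟨fun h => mem_iUnion.2 ⟨⟨x, hx⟩, h, rfl⟩, fun h => ?_⟩
    obtain ⟨i, hi, -⟩ := mem_iUnion.1 h
    exact hi
  rw [hsum, measure_iUnion _ fun i => hs.inter (measurableSet_singleton _),
    Measure.sum_apply _ hs]
  · refine tsum_congr fun i => ?_
    rw [ofReal_measureReal, Measure.smul_apply, Measure.dirac_apply' _ hs, smul_eq_mul]
    by_cases hi : (i : X) ∈ s
    · simp [hi]
    · simp [hi]
  · intro i j hij
    refine Disjoint.mono inter_subset_right inter_subset_right ?_
    simpa [Subtype.ext_iff] using hij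

/-- For `0 < P < R`, the quantity `(K * t ^ (1 / P)) ^ R` is `o(t)` as `t → 0⁺`. -/
lemma exists_forall_mul_rpow_rpow_le {K P R ε : ℝ} (hK : 0 < K) (hP : 0 < P) (hPR : P < R)
    (hε : 0 < ε) :
    ∃ t₀ > 0, ∀ t, 0 < t → t < t₀ →
      t ^ P⁻¹ ≤ 1 ∧ K * t ^ P⁻¹ ≤ 1 ∧ (K * t ^ P⁻¹) ^ R ≤ ε * t := by
  have hlim {a : ℝ} (ha : 0 < a) (L : ℝ) : Tendsto (fun t : ℝ => L * t ^ a) (𝓝 0) (𝓝 0) := by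
    have := ((Real.continuousAt_rpow_const 0 a (Or.inr ha.le)).tendsto).const_mul L
    simpa [Real.zero_rpow ha.ne'] using this
  have hP' : 0 < P⁻¹ := inv_pos.2 hP
  have hexp : 0 < P⁻¹ * R - 1 := by
    rw [sub_pos, inv_mul_eq_div, one_lt_div hP]
    exact hPR
  have hev : ∀ᶠ t : ℝ in 𝓝 0, 1 * t ^ P⁻¹ < 1 ∧ K * t ^ P⁻¹ < 1 ∧ K ^ R * t ^ (P⁻¹ * R - 1) < ε :=
    ((hlim hP' 1).eventually_lt_const one_pos).and
      (((hlim hP' K).eventually_lt_const one_pos).and ((hlim hexp _).eventually_lt_const hε))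
  obtain ⟨t₀, ht₀, h⟩ := Metric.eventually_nhds_iff.1 hev
  refine ⟨t₀, ht₀, fun t ht htt₀ => ?_⟩
  obtain ⟨h₁, h₂, h₃⟩ := h (y := t) (by simpa [abs_of_pos ht] using htt₀)
  refine ⟨by simpa using h₁.le, h₂.le, ?_⟩
  rw [Real.mul_rpow hK.le (by positivity), ← Real.rpow_mul ht.le,
    ← sub_add_cancel (P⁻¹ * R) 1, Real.rpow_add_one ht.ne', ← mul_assoc]
  exact mul_le_mul_of_nonneg_right h₃.le ht.le

section Luxemburg

variable {N : ℕ} {μ : Measure (EuclideanSpace ℝ (Fin N))} {φ p : EuclideanSpace ℝ (Fin N) → ℝ}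

lemma luxNormM_le {c : ℝ} (hc : 0 < c) (h : ∫ x, |φ x / c| ^ p x ∂μ ≤ 1) : luxNormM μ p φ ≤ c :=
  csInf_le ⟨0, fun _ hb => hb.1.le⟩ ⟨hc, h⟩

/-- A function with values in `[0, 1]` and supported in `U` has Luxemburg norm at most `c ≤ 1` as
soon as `μ U ≤ c ^ P`, where `P` bounds the exponent on `U`. -/
lemma luxNormM_le_of_support_subset [IsFiniteMeasure μ] {U : Set (EuclideanSpace ℝ (Fin N))}
    {P c : ℝ} (hU : MeasurableSet U) (hφ : ∀ x, φ x ∈ Icc 0 1) (hsupp : support φ ⊆ U)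
    (hp : ∀ x, 1 < p x) (hpP : ∀ x ∈ U, p x ≤ P) (hc : 0 < c) (hc1 : c ≤ 1)
    (hμU : μ.real U ≤ c ^ P) : luxNormM μ p φ ≤ c := by
  refine luxNormM_le hc ?_
  calc ∫ x, |φ x / c| ^ p x ∂μ
      ≤ ∫ x, U.indicator (fun _ => (c ^ P)⁻¹) x ∂μ := by
        refine integral_mono_of_nonneg (Eventually.of_forall fun x => by positivity)
          ((integrable_const _).indicator hU) (Eventually.of_forall fun x => ?_)
        by_cases hx : x ∈ U
        · have hle : |φ x / c| ≤ c⁻¹ := by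
            rw [abs_of_nonneg (div_nonneg (hφ x).1 hc.le), div_eq_mul_inv]
            exact mul_le_of_le_one_left (by positivity) (hφ x).2
          simp only [indicator_of_mem hx]
          calc |φ x / c| ^ p x ≤ c⁻¹ ^ p x :=
                Real.rpow_le_rpow (abs_nonneg _) hle (by linarith [hp x])
            _ ≤ c⁻¹ ^ P := Real.rpow_le_rpow_of_exponent_le ((one_le_inv₀ hc).2 hc1) (hpP x hx)
            _ = (c ^ P)⁻¹ := Real.inv_rpow hc.le P
        · have h0 : φ x = 0 := by_contra fun h => hx (hsupp h)
          simp [hx, h0, Real.zero_rpow (by linarith [hp x] : p x ≠ 0)]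
    _ = μ.real U * (c ^ P)⁻¹ := by
        rw [integral_indicator hU, setIntegral_const, smul_eq_mul]
    _ ≤ 1 := by
        rw [← div_eq_mul_inv]
        exact div_le_one_of_le₀ hμU (by positivity)

/-- A function with values in `[0, 1]` has finite Luxemburg norm. -/
lemma luxNormM_set_nonempty [IsFiniteMeasure μ] (hφ : ∀ x, φ x ∈ Icc 0 1) (hp : ∀ x, 1 < p x) :
    {c : ℝ | 0 < c ∧ ∫ x, |φ x / c| ^ p x ∂μ ≤ 1}.Nonempty := by
  have hc : 1 ≤ μ.real univ + 1 := by linarith [measureReal_nonneg (μ := μ) (s := univ)]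
  set c := μ.real univ + 1 with hcdef
  have hc0 : 0 < c := by linarith
  refine ⟨c, hc0, ?_⟩
  calc ∫ x, |φ x / c| ^ p x ∂μ ≤ ∫ _, c⁻¹ ∂μ := by
        refine integral_mono_of_nonneg (Eventually.of_forall fun x => by positivity)
          (integrable_const _) (Eventually.of_forall fun x => ?_)
        have hle : |φ x / c| ≤ c⁻¹ := by
          rw [abs_of_nonneg (div_nonneg (hφ x).1 hc0.le), div_eq_mul_inv]
          exact mul_le_of_le_one_left (by positivity) (hφ x).2
        calc |φ x / c| ^ p x ≤ |φ x / c| ^ (1 : ℝ) :=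
              Real.rpow_le_rpow_of_exponent_ge' (abs_nonneg _) (hle.trans (inv_le_one_of_one_le₀ hc))
                zero_le_one (hp x).le
          _ ≤ c⁻¹ := by rwa [Real.rpow_one]
    _ = μ.real univ * c⁻¹ := by rw [integral_const, smul_eq_mul]
    _ ≤ 1 := by
        rw [← div_eq_mul_inv]
        exact div_le_one_of_le₀ (by linarith) hc0.le

/-- Chebyshev-type inequality: if `φ = 1` on `K`, the exponent is at least `R ≥ 0` on `K` and the
Luxemburg norm of `φ` is less than `a ≤ 1`, then `μ K ≤ a ^ R`. -/
lemma measureReal_le_of_luxNormM_lt [IsFiniteMeasure μ] {K : Set (EuclideanSpace ℝ (Fin N))}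
    {R a : ℝ} (hK : MeasurableSet K) (hφc : Continuous φ) (hφs : HasCompactSupport φ)
    (hφ : ∀ x, φ x ∈ Icc 0 1) (hφK : ∀ x ∈ K, φ x = 1) (hpc : Continuous p) (hp : ∀ x, 1 < p x)
    (hR : 0 ≤ R) (hRp : ∀ x ∈ K, R ≤ p x) (ha : a ≤ 1) (hlt : luxNormM μ p φ < a) :
    μ.real K ≤ a ^ R := by
  obtain ⟨c, ⟨hc, hint⟩, hca⟩ := exists_lt_of_csInf_lt (luxNormM_set_nonempty hφ hp) hlt
  have hcont : Continuous fun x => |φ x / c| ^ p x :=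
    (hφc.div_const c).abs.rpow hpc fun x => Or.inr (by linarith [hp x])
  have hcs : HasCompactSupport fun x => |φ x / c| ^ p x := by
    refine hφs.mono fun x hx hφx => hx ?_
    simp [hφx, Real.zero_rpow (by linarith [hp x] : p x ≠ 0)]
  have hkey : μ.real K * (c ^ R)⁻¹ ≤ 1 := by
    calc μ.real K * (c ^ R)⁻¹ = ∫ x, K.indicator (fun _ => (c ^ R)⁻¹) x ∂μ := by
          rw [integral_indicator hK, setIntegral_const, smul_eq_mul]
      _ ≤ ∫ x, |φ x / c| ^ p x ∂μ := by
          refine integral_mono ((integrable_const _).indicator hK)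
            (hcont.integrable_of_hasCompactSupport hcs) fun x => ?_
          by_cases hx : x ∈ K
          · simp only [indicator_of_mem hx, hφK x hx, one_div, abs_of_pos (inv_pos.2 hc)]
            rw [← Real.inv_rpow hc.le]
            exact Real.rpow_le_rpow_of_exponent_le ((one_le_inv₀ hc).2 (hca.le.trans ha)) (hRp x hx)
          · simp only [indicator_of_notMem hx]
            positivity
      _ ≤ 1 := hint
  rw [← div_eq_mul_inv, div_le_one (by positivity)] at hkey
  exact hkey.trans (Real.rpow_le_rpow hc.le hca.le hR)

end Luxemburg

/-- Smooth Urysohn function with compact support, between a compact set and an open set. -/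
lemma exists_contDiff_hasCompactSupport_one_on {E : Type*} [NormedAddCommGroup E]
    [NormedSpace ℝ E] [FiniteDimensional ℝ E] {K U : Set E} (hK : IsCompact K) (hU : IsOpen U)
    (hKU : K ⊆ U) :
    ∃ φ : E → ℝ, ContDiff ℝ (⊤ : ℕ∞) φ ∧ HasCompactSupport φ ∧ (∀ x, φ x ∈ Icc 0 1) ∧
      support φ ⊆ U ∧ ∀ x ∈ K, φ x = 1 := by
  obtain ⟨L, hL, hKL, hLU⟩ := exists_compact_between hK hU hKU
  obtain ⟨φ, hφ, hrange, hsupp, hone⟩ := exists_contMDiff_support_eq_eq_one_iff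
    (n := (⊤ : ℕ∞)) (modelWithCornersSelf ℝ E) isOpen_interior hK.isClosed hKL
  have hsL : support φ ⊆ L := hsupp.trans_subset interior_subset
  exact ⟨φ, hφ.contDiff, HasCompactSupport.of_support_subset_isCompact hL hsL,
    fun x => hrange (mem_range_self x), hsL.trans hLU, fun x hx => (hone x).1 hx⟩

/-- Around a point that is not an atom of `μ`, the reverse Hölder inequality bounds `ν` by
arbitrarily small multiples of `μ`. -/
lemma exists_isOpen_measure_le_mul_of_reverse_holder {N : ℕ}
    {μ ν : Measure (EuclideanSpace ℝ (Fin N))} [IsFiniteMeasure μ] [IsFiniteMeasure ν]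
    {p r : EuclideanSpace ℝ (Fin N) → ℝ} (hpc : Continuous p) (hrc : Continuous r)
    (hp : ∀ x, 1 < p x) (hr : ∀ x, 1 < r x) (hpr : ∀ x, p x < r x) {C : ℝ} (hC : 0 < C)
    (hineq : ∀ φ : EuclideanSpace ℝ (Fin N) → ℝ, ContDiff ℝ (⊤ : ℕ∞) φ → HasCompactSupport φ →
      luxNormM ν r φ ≤ C * luxNormM μ p φ)
    {x₀ : EuclideanSpace ℝ (Fin N)} (hx₀ : μ {x₀} = 0) {ε : ℝ} (hε : 0 < ε) :
    ∃ V, IsOpen V ∧ x₀ ∈ V ∧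
      ∀ A ⊆ V, MeasurableSet A → ν A ≤ ENNReal.ofReal ε * μ A := by
  obtain ⟨P, hpP, hPr⟩ := exists_between (hpr x₀)
  obtain ⟨R, hPR, hRr⟩ := exists_between hPr
  have hP : 0 < P := by linarith [hp x₀]
  obtain ⟨t₀, ht₀, ht⟩ :=
    exists_forall_mul_rpow_rpow_le (K := 2 * C) (by positivity) hP hPR hε
  obtain ⟨W, hxW, hWo, hμW⟩ := ({x₀} : Set (EuclideanSpace ℝ (Fin N))).exists_isOpen_lt_of_lt
    (μ := μ) (ENNReal.ofReal t₀) (by simpa [hx₀] using ht₀)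
  let V := W ∩ ({x | p x < P} ∩ {x | R < r x})
  have hVo : IsOpen V :=
    hWo.inter ((isOpen_lt hpc continuous_const).inter (isOpen_lt continuous_const hrc))
  refine ⟨V, hVo, ⟨hxW rfl, hpP, hRr⟩, fun A hAV hA => ?_⟩
  have key : ∀ t : ℝ, 0 < t → t < t₀ → μ A < ENNReal.ofReal t → ν A ≤ ENNReal.ofReal (ε * t) := by
    intro t ht0 htt₀ hμt
    obtain ⟨hc1, hKc, hle⟩ := ht t ht0 htt₀
    obtain ⟨U, hAU, hUo, hμU⟩ := A.exists_isOpen_lt_of_lt _ hμt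
    refine le_of_forall_lt fun s hs => ?_
    obtain ⟨K, hKA, hK, hsK⟩ := hA.exists_lt_isCompact_of_ne_top (measure_ne_top ν A) hs
    refine hsK.trans_le ?_
    obtain ⟨φ, hφ, hφs, hφ01, hφU, hφK⟩ := exists_contDiff_hasCompactSupport_one_on hK
      (hUo.inter hVo) (fun x hx => ⟨hAU (hKA hx), hAV (hKA hx)⟩)
    have hc : 0 < t ^ P⁻¹ := by positivity
    have hnorm : luxNormM μ p φ ≤ t ^ P⁻¹ := by
      refine luxNormM_le_of_support_subset (P := P) (hUo.inter hVo).measurableSet hφ01 hφU hp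
        (fun x hx => hx.2.2.1.le) hc hc1 ?_
      rw [Real.rpow_inv_rpow ht0.le hP.ne']
      exact (measureReal_mono inter_subset_left).trans
        (ENNReal.toReal_le_of_le_ofReal ht0.le hμU.le)
    have hlt : luxNormM ν r φ < 2 * C * t ^ P⁻¹ := by
      have := mul_le_mul_of_nonneg_left hnorm hC.le
      nlinarith [hineq φ hφ hφs, mul_pos hC hc]
    have := (measureReal_le_of_luxNormM_lt hK.measurableSet hφ.continuous hφs hφ01 hφK hrc hr
      (hP.trans hPR).le (fun x hx => (hAV (hKA hx)).2.2.le) hKc hlt).trans hle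
    rw [← ofReal_measureReal (μ := ν) (s := K)]
    exact ENNReal.ofReal_le_ofReal this
  have hμA : μ.real A < t₀ := by
    have : μ A < ENNReal.ofReal t₀ := (measure_mono (hAV.trans inter_subset_left)).trans_lt hμW
    exact (ENNReal.lt_ofReal_iff_toReal_lt (measure_ne_top _ _)).1 this
  rw [← ofReal_measureReal (μ := μ) (s := A), ← ENNReal.ofReal_mul hε.le]
  have hlim : Tendsto (fun t : ℝ => ENNReal.ofReal (ε * t)) (𝓝[>] (μ.real A))
      (𝓝 (ENNReal.ofReal (ε * μ.real A))) :=
    (ENNReal.continuous_ofReal.comp (continuous_const_mul ε)).continuousAt.mono_left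
      nhdsWithin_le_nhds
  refine ge_of_tendsto hlim ?_
  filter_upwards [Ioo_mem_nhdsGT hμA] with t hAt
  exact key t (measureReal_nonneg.trans_lt hAt.1) hAt.2
    ((ENNReal.lt_ofReal_iff_toReal_lt (measure_ne_top _ _)).2 hAt.1)

/-- If the reverse Hölder inequality `|φ|_{L^{r(x)}_ν} ≤ C |φ|_{L^{p(x)}_μ}` holds for all
`φ ∈ C_c^∞(ℝ^N)` with `inf (r - p) > 0`, then `ν` is a countable sum of Dirac masses. -/
theorem measure_eq_countable_sum_dirac_of_reverse_holder
    (N : ℕ) (μ ν : Measure (EuclideanSpace ℝ (Fin N)))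
    (hμ : IsFiniteMeasure μ) (hν : IsFiniteMeasure ν)
    (p r : EuclideanSpace ℝ (Fin N) → ℝ) (hpc : Continuous p) (hrc : Continuous r)
    (hp1 : 1 < sInf (Set.range p)) (hpbdd : BddAbove (Set.range p))
    (hr1 : 1 < sInf (Set.range r)) (hrbdd : BddAbove (Set.range r))
    (hgap : 0 < sInf (Set.range (fun x => r x - p x)))
    (C : ℝ) (hC : 0 < C)
    (hineq : ∀ φ : EuclideanSpace ℝ (Fin N) → ℝ, ContDiff ℝ (⊤ : ℕ∞) φ → HasCompactSupport φ →
      luxNormM ν r φ ≤ C * luxNormM μ p φ) :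
    ∃ (ι : Type) (_ : Countable ι) (x : ι → EuclideanSpace ℝ (Fin N)) (c : ι → ℝ),
      Function.Injective x ∧ (∀ i, 0 < c i) ∧
      ν = Measure.sum (fun i => (ENNReal.ofReal (c i)) • Measure.dirac (x i)) := by
  have lt_of_lt_sInf {f : EuclideanSpace ℝ (Fin N) → ℝ} {a : ℝ} (ha : 0 ≤ a)
      (h : a < sInf (Set.range f)) (x : EuclideanSpace ℝ (Fin N)) : a < f x := by
    refine h.trans_le (csInf_le (by_contra fun hb => ?_) (Set.mem_range_self x))
    rw [Real.sInf_of_not_bddBelow hb] at h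
    exact absurd h ha.not_gt
  let D := {x | 0 < μ {x}}
  have hD : D.Countable := Measure.countable_meas_pos_of_disjoint_iUnion
    (fun x => measurableSet_singleton x) fun _ _ hxy => Set.disjoint_singleton.2 hxy
  refine exists_eq_sum_dirac_of_countable hD ?_
  have hle (ε : ℝ) (hε : 0 < ε) : ν Dᶜ ≤ ENNReal.ofReal ε * μ Dᶜ :=
    measure_le_mul_of_forall_exists_isOpen hD.measurableSet.compl fun x hx =>
      exists_isOpen_measure_le_mul_of_reverse_holder hpc hrc (lt_of_lt_sInf zero_le_one hp1)
        (lt_of_lt_sInf zero_le_one hr1) (fun x => sub_pos.1 (lt_of_lt_sInf le_rfl hgap x)) hC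
        hineq (by simpa [D] using hx) hε
  have hlim : Tendsto (fun ε : ℝ => ENNReal.ofReal ε * μ Dᶜ) (𝓝[>] 0) (𝓝 0) := by
    have := ENNReal.Tendsto.mul_const (b := μ Dᶜ)
      (ENNReal.continuous_ofReal.tendsto 0) (Or.inr (measure_ne_top _ _))
    simpa using this.mono_left (nhdsWithin_le_nhds (s := Set.Ioi 0))
  exact le_antisymm (ge_of_tendsto hlim (eventually_mem_nhdsWithin.mono hle)) zero_le
end

section
/- Let ν be a nonnegative finite Borel measure on ℝ^N and suppose there exists a constant C > 0 such that |φ|_{L^{r(x)}_ν(ℝ^N)} ≤ C |φ|_{L^{p(x)}_ν(ℝ^N)} for all φ ∈ C_c^∞(ℝ^N), where p, r : ℝ^N → ℝ are continuous with 1 < inf p ≤ sup p < ∞, 1 < inf r ≤ sup r < ∞, and inf_{ℝ^N}(r − p) > 0. Then either ν = 0, or there exist finitely many distinct points x_1, …, x_n ∈ ℝ^N and positive numbers ν_1, …, ν_n such that ν = Σ_{i=1}^n ν_i δ_{x_i}, where δ_{x_i} is the Dirac measure at x_i. -/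
open MeasureTheory Filter Topology

section LuxemburgBounds

variable {N : ℕ} {ν : Measure (EuclideanSpace ℝ (Fin N))}
  {q φ : EuclideanSpace ℝ (Fin N) → ℝ} {a : ℝ}

/-- The modular of a continuous compactly supported function is finite. -/
lemma integrable_abs_div_rpow [IsFiniteMeasure ν] (hq : Continuous q) (hq0 : ∀ x, 0 < q x)
    (hφ : Continuous φ) (hφc : HasCompactSupport φ) (c : ℝ) :
    Integrable (fun x => |φ x / c| ^ q x) ν := by
  apply Continuous.integrable_of_hasCompactSupport
  · exact ((hφ.div_const c).abs).rpow hq fun x => Or.inr (hq0 x)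
  · refine hφc.mono fun x hx => ?_
    contrapose! hx
    simp only [Function.mem_support, not_not] at hx ⊢
    simp [hx, Real.zero_rpow (hq0 x).ne']

/-- A function with values in `[0, 1]`, supported in a set `B` of measure at most one on which the
exponent is at most `a`, has Luxemburg norm at most `ν(B)^(1/a)`. -/
lemma luxNormM_le_measureReal_rpow [IsFiniteMeasure ν] {B : Set (EuclideanSpace ℝ (Fin N))}
    (hB : MeasurableSet B) (hq : Continuous q) (hq0 : ∀ x, 0 < q x)
    (hφ : Continuous φ) (hφc : HasCompactSupport φ) (hφ0 : ∀ x, 0 ≤ φ x) (hφ1 : ∀ x, φ x ≤ 1)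
    (hφB : ∀ x, x ∉ B → φ x = 0) (ha : 0 < a) (hqa : ∀ x ∈ B, q x ≤ a)
    (hpos : 0 < ν.real B) (hle : ν.real B ≤ 1) :
    luxNormM ν q φ ≤ ν.real B ^ (1 / a) := by
  set c := ν.real B ^ (1 / a) with hc
  have hc0 : 0 < c := Real.rpow_pos_of_pos hpos _
  have hc1 : c ≤ 1 := Real.rpow_le_one hpos.le hle (by positivity)
  have hca : c ^ a = ν.real B := by
    rw [hc, ← Real.rpow_mul hpos.le, one_div_mul_cancel ha.ne', Real.rpow_one]
  refine csInf_le ⟨0, fun t ht => ht.1.le⟩ ⟨hc0, ?_⟩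
  calc ∫ x, |φ x / c| ^ q x ∂ν
      ≤ ∫ x, B.indicator (fun _ => (1 / c) ^ a) x ∂ν := by
        refine integral_mono (integrable_abs_div_rpow hq hq0 hφ hφc c)
          ((integrable_const _).indicator hB) fun x => ?_
        by_cases hx : x ∈ B
        · simp only [Set.indicator_of_mem hx]
          rw [abs_of_nonneg (div_nonneg (hφ0 x) hc0.le)]
          calc (φ x / c) ^ q x ≤ (1 / c) ^ q x :=
                Real.rpow_le_rpow (div_nonneg (hφ0 x) hc0.le)
                  (div_le_div_of_nonneg_right (hφ1 x) hc0.le) (hq0 x).le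
            _ ≤ (1 / c) ^ a :=
                Real.rpow_le_rpow_of_exponent_le ((one_le_div hc0).2 hc1) (hqa x hx)
        · simp [Set.indicator_of_notMem hx, hφB x hx, Real.zero_rpow (hq0 x).ne']
    _ = ν.real B * (1 / c) ^ a := by
        rw [integral_indicator hB, setIntegral_const, smul_eq_mul]
    _ ≤ 1 := by
        rw [one_div, Real.inv_rpow hc0.le, hca, mul_inv_cancel₀ hpos.ne']

/-- A function with values in `[0, 1]`, equal to one on a set `A` on which the exponent is at
least `a`, and whose support has measure at most one, has Luxemburg norm at least `ν(A)^(1/a)`. -/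
lemma measureReal_rpow_le_luxNormM [IsFiniteMeasure ν] {A B : Set (EuclideanSpace ℝ (Fin N))}
    (hA : MeasurableSet A) (hB : MeasurableSet B) (hAB : A ⊆ B)
    (hq : Continuous q) (hq0 : ∀ x, 0 < q x)
    (hφ : Continuous φ) (hφc : HasCompactSupport φ) (hφ0 : ∀ x, 0 ≤ φ x) (hφ1 : ∀ x, φ x ≤ 1)
    (hφA : ∀ x ∈ A, φ x = 1) (hφB : ∀ x, x ∉ B → φ x = 0) (ha : 0 < a)
    (hqa : ∀ x ∈ A, a ≤ q x) (hle : ν.real B ≤ 1) :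
    ν.real A ^ (1 / a) ≤ luxNormM ν q φ := by
  have hA1 : ν.real A ≤ 1 := (measureReal_mono hAB).trans hle
  refine le_csInf ⟨1, one_pos, ?_⟩ ?_
  · calc ∫ x, |φ x / 1| ^ q x ∂ν
        ≤ ∫ x, B.indicator (fun _ => (1 : ℝ)) x ∂ν := by
          refine integral_mono (integrable_abs_div_rpow hq hq0 hφ hφc 1)
            ((integrable_const _).indicator hB) fun x => ?_
          by_cases hx : x ∈ B
          · simp only [Set.indicator_of_mem hx, div_one, abs_of_nonneg (hφ0 x)]
            exact Real.rpow_le_one (hφ0 x) (hφ1 x) (hq0 x).le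
          · simp [Set.indicator_of_notMem hx, hφB x hx, Real.zero_rpow (hq0 x).ne']
      _ ≤ 1 := by
          rw [integral_indicator hB, setIntegral_const, smul_eq_mul, mul_one]
          exact hle
  · rintro c ⟨hc0, hc⟩
    by_contra! hlt
    have hc1 : c ≤ 1 := hlt.le.trans (Real.rpow_le_one measureReal_nonneg hA1 (by positivity))
    have hca : c ^ a < ν.real A := by
      have h := Real.rpow_lt_rpow hc0.le hlt ha
      rwa [← Real.rpow_mul measureReal_nonneg, one_div_mul_cancel ha.ne', Real.rpow_one] at h
    have hint : ν.real A * (1 / c) ^ a ≤ ∫ x, |φ x / c| ^ q x ∂ν := by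
      calc ν.real A * (1 / c) ^ a = ∫ x, A.indicator (fun _ => (1 / c) ^ a) x ∂ν := by
            rw [integral_indicator hA, setIntegral_const, smul_eq_mul]
        _ ≤ _ := by
            refine integral_mono ((integrable_const _).indicator hA)
              (integrable_abs_div_rpow hq hq0 hφ hφc c) fun x => ?_
            by_cases hx : x ∈ A
            · simp only [Set.indicator_of_mem hx, hφA x hx]
              rw [abs_of_nonneg (by positivity)]
              exact Real.rpow_le_rpow_of_exponent_le ((one_le_div hc0).2 hc1) (hqa x hx)
            · simp only [Set.indicator_of_notMem hx]
              positivity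
    have hcp : 0 < c ^ a := Real.rpow_pos_of_pos hc0 a
    rw [one_div, Real.inv_rpow hc0.le] at hint
    have : 1 < ν.real A * (c ^ a)⁻¹ := by
      rwa [← div_eq_mul_inv, one_lt_div hcp]
    linarith

/-- If the reverse Hölder inequality holds and `p ≤ a`, `b ≤ r` on a ball of measure at most one,
then the measure of the ball satisfies the corresponding inequality for indicators. -/
lemma measureReal_ball_rpow_le [IsFiniteMeasure ν] {p r : EuclideanSpace ℝ (Fin N) → ℝ} {b C : ℝ}
    (hpc : Continuous p) (hrc : Continuous r) (hp0 : ∀ x, 0 < p x) (hr0 : ∀ x, 0 < r x)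
    (hC : 0 ≤ C)
    (hineq : ∀ φ : EuclideanSpace ℝ (Fin N) → ℝ, ContDiff ℝ (⊤ : ℕ∞) φ → HasCompactSupport φ →
      luxNormM ν r φ ≤ C * luxNormM ν p φ)
    {x₀ : EuclideanSpace ℝ (Fin N)} {s : ℝ} (hs : 0 < s) (ha : 0 < a) (hb : 0 < b)
    (hpa : ∀ x ∈ Metric.ball x₀ s, p x ≤ a) (hbr : ∀ x ∈ Metric.ball x₀ s, b ≤ r x)
    (hpos : 0 < ν.real (Metric.ball x₀ s)) (hle : ν.real (Metric.ball x₀ s) ≤ 1) :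
    ν.real (Metric.ball x₀ s) ^ (1 / b) ≤ C * ν.real (Metric.ball x₀ s) ^ (1 / a) := by
  have key : ∀ t, 0 < t → t < s →
      ν.real (Metric.closedBall x₀ t) ^ (1 / b) ≤ C * ν.real (Metric.ball x₀ s) ^ (1 / a) := by
    intro t ht hts
    let f : ContDiffBump x₀ := ⟨t, s, ht, hts⟩
    have hfB : ∀ x, x ∉ Metric.ball x₀ s → f x = 0 := fun x hx =>
      f.zero_of_le_dist (by simpa using hx)
    have hsub : Metric.closedBall x₀ t ⊆ Metric.ball x₀ s := Metric.closedBall_subset_ball hts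
    calc ν.real (Metric.closedBall x₀ t) ^ (1 / b) ≤ luxNormM ν r f :=
          measureReal_rpow_le_luxNormM measurableSet_closedBall measurableSet_ball hsub hrc hr0
            f.continuous f.hasCompactSupport (fun _ => f.nonneg) (fun _ => f.le_one)
            (fun x hx => f.one_of_mem_closedBall hx) hfB hb (fun x hx => hbr x (hsub hx)) hle
      _ ≤ C * luxNormM ν p f := hineq f f.contDiff f.hasCompactSupport
      _ ≤ _ := mul_le_mul_of_nonneg_left
          (luxNormM_le_measureReal_rpow measurableSet_ball hpc hp0 f.continuous
            f.hasCompactSupport (fun _ => f.nonneg) (fun _ => f.le_one) hfB ha hpa hpos hle) hC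
  obtain ⟨u, hu_mono, hu_mem, hu_lim⟩ := exists_seq_strictMono_tendsto' hs
  have hunion : ⋃ n, Metric.closedBall x₀ (u n) = Metric.ball x₀ s := by
    ext x
    simp only [Set.mem_iUnion, Metric.mem_closedBall, Metric.mem_ball]
    constructor
    · rintro ⟨n, hn⟩
      exact hn.trans_lt (hu_mem n).2
    · intro hx
      obtain ⟨n, hn⟩ := (hu_lim.eventually (lt_mem_nhds hx)).exists
      exact ⟨n, hn.le⟩
  have hlim : Tendsto (fun n => ν.real (Metric.closedBall x₀ (u n))) atTop
      (𝓝 (ν.real (Metric.ball x₀ s))) := by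
    have h := tendsto_measure_iUnion_atTop (μ := ν)
      (s := fun n => Metric.closedBall x₀ (u n))
      (fun m n hmn => Metric.closedBall_subset_closedBall (hu_mono.monotone hmn))
    rw [hunion] at h
    exact (ENNReal.tendsto_toReal (measure_ne_top _ _)).comp h
  exact le_of_tendsto (hlim.rpow_const (Or.inr (by positivity)))
    (Eventually.of_forall fun n => key (u n) (hu_mem n).1 (hu_mem n).2)

end LuxemburgBounds

/-- An inequality `M^(1/b) ≤ C M^(1/a)` with `a < b` bounds `M ∈ (0, 1]` from below. -/
lemma rpow_neg_inv_le_of_rpow_le {M C a b e : ℝ} (hM0 : 0 < M) (hM1 : M ≤ 1) (hC : 0 < C)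
    (he : 0 < e) (heab : e ≤ 1 / a - 1 / b) (h : M ^ (1 / b) ≤ C * M ^ (1 / a)) :
    C ^ (-(1 / e)) ≤ M := by
  have h1 : 1 ≤ C * M ^ e := by
    have hp : 0 < M ^ (1 / b) := Real.rpow_pos_of_pos hM0 _
    have h2 : M ^ (1 / a) ≤ M ^ e * M ^ (1 / b) := by
      rw [← Real.rpow_add hM0]
      exact Real.rpow_le_rpow_of_exponent_ge hM0 hM1 (by linarith)
    have h3 : 1 * M ^ (1 / b) ≤ (C * M ^ e) * M ^ (1 / b) := by
      rw [one_mul, mul_assoc]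
      exact h.trans (mul_le_mul_of_nonneg_left h2 hC.le)
    exact le_of_mul_le_mul_right h3 hp
  have h4 : C⁻¹ ≤ M ^ e := by
    rwa [inv_le_iff_one_le_mul₀' hC]
  have h5 := Real.rpow_le_rpow (inv_nonneg.2 hC.le) h4 (one_div_pos.2 he).le
  rwa [← Real.rpow_mul hM0.le, mul_one_div_cancel he.ne', Real.rpow_one, Real.inv_rpow hC.le,
    ← Real.rpow_neg hC.le] at h5

/-- A finite measure whose atoms of mass at least `δ > 0` fill its support is a finite sum of
Dirac masses. -/
lemma exists_eq_sum_dirac_of_measure_singleton_ge {X : Type*} [TopologicalSpace X]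
    [SecondCountableTopology X] [MeasurableSpace X] [MeasurableSingletonClass X]
    (ν : Measure X) [IsFiniteMeasure ν] {δ : ENNReal} (hδ : 0 < δ)
    (h : ∀ x, (∀ U ∈ 𝓝 x, 0 < ν U) → δ ≤ ν {x}) :
    ∃ (n : ℕ) (x : Fin n → X) (c : Fin n → ℝ),
      Function.Injective x ∧ (∀ i, 0 < c i) ∧
      ν = ∑ i, (ENNReal.ofReal (c i)) • Measure.dirac (x i) := by
  have hfin : {x | δ ≤ ν {x}}.Finite :=
    Measure.finite_const_le_meas_of_disjoint_iUnion ν hδ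
      (fun x => measurableSet_singleton x)
      (fun x y hxy => Set.disjoint_singleton.2 hxy) (measure_ne_top _ _)
  set T := hfin.toFinset with hT
  have hnull : ν (T : Set X)ᶜ = 0 := by
    refine measure_null_of_locally_null _ fun x hx => ?_
    have hx' : ¬ δ ≤ ν {x} := by simpa [hT] using hx
    have h' := mt (h x) hx'
    push Not at h'
    obtain ⟨U, hU, hU0⟩ := h'
    exact ⟨U, mem_nhdsWithin_of_mem_nhds hU, le_antisymm hU0 zero_le⟩
  have hpos : ∀ x ∈ T, 0 < ν {x} := fun x hx => hδ.trans_le (by simpa [hT] using hx)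
  have hsum : ν = ∑ x ∈ T, ν {x} • Measure.dirac x := by
    have hres : ν.restrict (T : Set X) = ν :=
      Measure.restrict_eq_self_of_ae_mem (by rwa [ae_iff])
    ext A hA
    conv_lhs => rw [← hres, Measure.restrict_apply hA]
    classical
    have hset : A ∩ (T : Set X) = ((T.filter (· ∈ A) : Finset X) : Set X) := by
      ext y; simp [and_comm]
    rw [hset, ← sum_measure_singleton, Finset.sum_filter, Measure.finsetSum_apply]
    refine Finset.sum_congr rfl fun y _ => ?_
    by_cases hy : y ∈ A <;> simp [hA, hy]
  refine ⟨T.card, fun i => (T.equivFin.symm i : X), fun i => ν.real {(T.equivFin.symm i : X)},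
    Subtype.val_injective.comp T.equivFin.symm.injective, fun i => ?_, ?_⟩
  · exact ENNReal.toReal_pos (hpos _ (T.equivFin.symm i).2).ne' (measure_ne_top _ _)
  · conv_lhs => rw [hsum]
    rw [← Finset.sum_coe_sort, ← T.equivFin.symm.sum_comp]
    simp

/-- If the reverse Hölder inequality `|φ|_{L^{r(x)}_ν} ≤ C |φ|_{L^{p(x)}_ν}` holds for all
`φ ∈ C_c^∞(ℝ^N)` with `inf (r - p) > 0`, then `ν = 0` or `ν` is a finite sum of Dirac masses. -/
theorem measure_eq_finite_sum_dirac_of_reverse_holder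
    (N : ℕ) (ν : Measure (EuclideanSpace ℝ (Fin N))) (hν : IsFiniteMeasure ν)
    (p r : EuclideanSpace ℝ (Fin N) → ℝ) (hpc : Continuous p) (hrc : Continuous r)
    (hp1 : 1 < sInf (Set.range p)) (hpbdd : BddAbove (Set.range p))
    (hr1 : 1 < sInf (Set.range r)) (hrbdd : BddAbove (Set.range r))
    (hgap : 0 < sInf (Set.range (fun x => r x - p x)))
    (C : ℝ) (hC : 0 < C)
    (hineq : ∀ φ : EuclideanSpace ℝ (Fin N) → ℝ, ContDiff ℝ (⊤ : ℕ∞) φ → HasCompactSupport φ →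
      luxNormM ν r φ ≤ C * luxNormM ν p φ) :
    ν = 0 ∨
      ∃ (n : ℕ) (x : Fin n → EuclideanSpace ℝ (Fin N)) (c : Fin n → ℝ),
        Function.Injective x ∧ (∀ i, 0 < c i) ∧
        ν = ∑ i, (ENNReal.ofReal (c i)) • Measure.dirac (x i) := by
  right
  have hbb : ∀ f : EuclideanSpace ℝ (Fin N) → ℝ, 0 < sInf (Set.range f) →
      ∀ x, sInf (Set.range f) ≤ f x := fun f hf x => by
    refine csInf_le ?_ ⟨x, rfl⟩
    by_contra hn
    exact hf.ne' (Real.sInf_of_not_bddBelow hn)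
  have hp0 : ∀ x, 0 < p x := fun x => by linarith [hbb p (by linarith) x]
  have hr0 : ∀ x, 0 < r x := fun x => by linarith [hbb r (by linarith) x]
  obtain ⟨P, hP⟩ := hpbdd
  have hpP : ∀ x, p x ≤ P := fun x => hP ⟨x, rfl⟩
  set γ := sInf (Set.range fun x => r x - p x)
  have hγr : ∀ x, p x + γ ≤ r x := fun x => by linarith [hbb _ hgap x]
  have hP0 : 0 < P := (hp0 0).trans_le (hpP 0)
  set e := γ / 2 / (P + γ) ^ 2 with he
  have he0 : 0 < e := by positivity
  set δ := min 1 (C ^ (-(1 / e)))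
  have hδ0 : 0 < δ := lt_min one_pos (Real.rpow_pos_of_pos hC _)
  refine exists_eq_sum_dirac_of_measure_singleton_ge ν (ENNReal.ofReal_pos.2 hδ0) fun x₀ hx₀ => ?_
  obtain ⟨ρ, hρ, hball⟩ := Metric.continuous_iff.1 hpc x₀ (γ / 4) (by positivity)
  have hbig : ∀ s, 0 < s → s < ρ → ENNReal.ofReal δ ≤ ν (Metric.ball x₀ s) := by
    intro s hs hsρ
    rw [ENNReal.ofReal_le_iff_le_toReal (measure_ne_top _ _)]
    change δ ≤ ν.real (Metric.ball x₀ s)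
    rcases le_total 1 (ν.real (Metric.ball x₀ s)) with h1 | h1
    · exact (min_le_left _ _).trans h1
    refine (min_le_right _ _).trans ?_
    have hpos : 0 < ν.real (Metric.ball x₀ s) :=
      ENNReal.toReal_pos (hx₀ _ (Metric.ball_mem_nhds x₀ hs)).ne' (measure_ne_top _ _)
    have hosc : ∀ x ∈ Metric.ball x₀ s, |p x - p x₀| < γ / 4 := fun x hx =>
      hball x ((Metric.mem_ball.1 hx).trans hsρ)
    have ha : 0 < p x₀ + γ / 4 := by linarith [hp0 x₀]
    have hb : 0 < p x₀ + 3 * γ / 4 := by linarith [hp0 x₀]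
    refine rpow_neg_inv_le_of_rpow_le hpos h1 hC he0 ?_
      (measureReal_ball_rpow_le (a := p x₀ + γ / 4) (b := p x₀ + 3 * γ / 4) hpc hrc hp0 hr0 hC.le
        hineq hs ha hb (fun x hx => ?_) (fun x hx => ?_) hpos h1)
    · have hab : 1 / (p x₀ + γ / 4) - 1 / (p x₀ + 3 * γ / 4) =
          γ / 2 / ((p x₀ + γ / 4) * (p x₀ + 3 * γ / 4)) := by
        rw [div_sub_div _ _ ha.ne' hb.ne']
        congr 1
        ring
      rw [hab, he, sq]
      have := hpP x₀
      gcongr <;> linarith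
    · linarith [(abs_lt.1 (hosc x hx)).2]
    · linarith [(abs_lt.1 (hosc x hx)).1, hγr x]
  obtain ⟨u, hu_anti, hu_mem, hu_lim⟩ := exists_seq_strictAnti_tendsto' hρ
  have hinter : ⋂ n, Metric.ball x₀ (u n) = {x₀} := by
    ext x
    simp only [Set.mem_iInter, Metric.mem_ball, Set.mem_singleton_iff]
    constructor
    · intro hx
      exact dist_le_zero.1 (ge_of_tendsto' hu_lim fun n => (hx n).le)
    · rintro rfl n
      simpa using (hu_mem n).1
  have hlim := tendsto_measure_iInter_atTop (μ := ν) (s := fun n => Metric.ball x₀ (u n))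
    (fun n => measurableSet_ball.nullMeasurableSet)
    (fun m n hmn => Metric.ball_subset_ball (hu_anti.antitone hmn)) ⟨0, measure_ne_top _ _⟩
  rw [hinter] at hlim
  exact ge_of_tendsto' hlim fun n => hbig (u n) (hu_mem n).1 (hu_mem n).2
end
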